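/- There exist an accuracy ε > 0 and a data set D (for instance n observations taking only two distinct values v_A and v_B, each with frequency n/2, with v_B − v_A ≥ 3ε, for suitable even n and E) such that every optimal histogram for D has at least one interval that contains no observation. -/

import Mathlib

open Real Finset

/-- Rissanen's universal code length for integers:
`log*(K) = log₂(2.865) + Σ_{j≥1} max(log₂^{(j)}(K), 0)`. -/
noncomputable def logStar (K : ℕ) : ℝ :=
  Real.logb 2 2.865 + ∑' j : ℕ, max ((fun x => Real.logb 2 x)^[j + 1] (K : ℝ)) 0

/-- A histogram model on the ε-grid built on the data range `[xmin, xmax]`,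
with `E` elementary ε-bins.  Intervals are `]c k, c (k+1)]` for `k < K`, with
count `h k`; the counts sum to `n`. -/
structure Histogram (n : ℕ) (ε xmin xmax : ℝ) (E : ℕ) where
  K : ℕ
  c : ℕ → ℝ
  h : ℕ → ℕ
  K_pos : 1 ≤ K
  c_mono : ∀ k < K, c k ≤ c (k + 1)
  c_first : c 0 = xmin - ε / 2
  c_last : c K = xmax + ε / 2
  c_grid : ∀ k ≤ K, ∃ t : ℕ, t ≤ E ∧ c k = xmin - ε / 2 + t * ε
  h_sum : ∑ k ∈ Finset.range K, h k = n

namespace Histogram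

variable {n : ℕ} {ε xmin xmax : ℝ} {E : ℕ}

open Classical in
/-- Compatibility of a histogram with a data set: the count of each
interval matches the number of observations that fall in it. -/
def Compatible (D : Fin n → ℝ) (M : Histogram n ε xmin xmax E) : Prop :=
  ∀ k < M.K,
    (Finset.univ.filter fun i => D i ∈ Set.Ioc (M.c k) (M.c (k + 1))).card = M.h k

/-- The Enum MDL criterion for histogram selection. -/
noncomputable def cEnum (M : Histogram n ε xmin xmax E) : ℝ :=
  logStar M.K + Real.log (Nat.choose (E + M.K - 1) (M.K - 1))
    + Real.log (Nat.choose (n + M.K - 1) (M.K - 1))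
    + (Real.log (Nat.factorial n)
        - ∑ k ∈ Finset.range M.K, Real.log (Nat.factorial (M.h k)))
    + ∑ k ∈ Finset.range M.K, (M.h k : ℝ) * Real.log ((M.c (k + 1) - M.c k) / ε)

/-- A histogram is optimal for `D` if it is compatible with `D` and minimizes
the Enum criterion among all compatible histograms on the same grid. -/
def Optimal (D : Fin n → ℝ) (M : Histogram n ε xmin xmax E) : Prop :=
  M.Compatible D ∧
    ∀ M' : Histogram n ε xmin xmax E, M'.Compatible D → M.cEnum ≤ M'.cEnum

end Histogram


noncomputable def exD : Fin 6 → ℝ := ![0, 0, 0, 100, 100, 100]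

abbrev exH := Histogram 6 1 0 100 101

open Classical in
lemma exD_count (a b : ℝ) :
    (Finset.univ.filter fun i => exD i ∈ Set.Ioc a b).card =
      (if a < 0 ∧ 0 ≤ b then 3 else 0) + (if a < 100 ∧ 100 ≤ b then 3 else 0) := by
  rw [Finset.card_filter, Fin.sum_univ_six]
  simp only [exD, Set.mem_Ioc]
  simp
  by_cases h1 : a < 0 ∧ 0 ≤ b <;> by_cases h2 : a < 100 ∧ 100 ≤ b <;> simp [h1, h2]

lemma logStar_ge (K : ℕ) : Real.logb 2 2.865 ≤ logStar K := by
  unfold logStar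
  have : 0 ≤ ∑' j : ℕ, max ((fun x => Real.logb 2 x)^[j + 1] (K : ℝ)) 0 :=
    tsum_nonneg fun j => le_max_right _ _
  linarith

lemma logb_four : Real.logb 2 4 = 2 := by
  rw [show (4 : ℝ) = 2 ^ (2 : ℝ) by norm_num, Real.logb_rpow (by norm_num) (by norm_num)]

lemma logStar_four : logStar 4 = Real.logb 2 2.865 + 3 := by
  unfold logStar
  have h0 : ∀ j : ℕ, (fun x => Real.logb 2 x)^[j + 3] ((4 : ℕ) : ℝ) = 0 := by
    intro j
    induction j with
    | zero => simp [logb_four]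
    | succ j ih =>
      rw [show j + 1 + 3 = (j + 3) + 1 by ring, Function.iterate_succ_apply', ih]; simp
  rw [tsum_eq_sum (s := Finset.range 2)]
  · simp [Finset.sum_range_succ, logb_four]; norm_num
  · intro j hj
    obtain ⟨i, rfl⟩ : ∃ i, j = i + 2 := ⟨j - 2, by simp at hj; omega⟩
    have := h0 i
    rw [show i + 2 + 1 = i + 3 by ring, this]; simp

noncomputable def exM : exH where
  K := 4
  c := fun k => if k = 0 then -1/2 else if k ≤ 2 then 1/2 else if k = 3 then 99 + 1/2 else 100 + 1/2
  h := fun k => if k = 0 then 3 else if k = 3 then 3 else 0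
  K_pos := by norm_num
  c_mono := by
    intro k hk
    interval_cases k <;> norm_num
  c_first := by norm_num
  c_last := by norm_num
  c_grid := by
    intro k hk
    interval_cases k
    · exact ⟨0, by norm_num, by norm_num⟩
    · exact ⟨1, by norm_num, by norm_num⟩
    · exact ⟨1, by norm_num, by norm_num⟩
    · exact ⟨100, by norm_num, by norm_num⟩
    · exact ⟨101, by norm_num, by norm_num⟩
  h_sum := by decide

lemma exM_compat : exM.Compatible exD := by
  intro k hk
  rw [exD_count]
  change k < 4 at hk
  simp only [exM]
  interval_cases k <;> norm_num

lemma exM_cost : exM.cEnum = Real.logb 2 2.865 + 3 + Real.log 182104 + Real.log 84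
    + (Real.log 720 - (Real.log 6 + Real.log 6)) := by
  have h1 : Nat.choose (101 + 4 - 1) (4 - 1) = 182104 := by norm_num [Nat.choose]
  have h2 : Nat.choose (6 + 4 - 1) (4 - 1) = 84 := by decide
  unfold Histogram.cEnum
  simp only [exM, logStar_four, h1, h2, Finset.sum_range_succ, Finset.sum_range_zero]
  norm_num [Nat.factorial]

lemma term_nonneg (M : exH) (hM : M.Compatible exD) (k : ℕ) (hk : k < M.K) :
    0 ≤ (M.h k : ℝ) * Real.log ((M.c (k + 1) - M.c k) / 1) := by
  by_cases h0 : M.h k = 0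
  · simp [h0]
  have hc := hM k hk
  rw [exD_count] at hc
  have hlt : M.c k < M.c (k+1) := by
    by_contra hcon
    rw [if_neg (by intro h; linarith [h.1, h.2]), if_neg (by intro h; linarith [h.1, h.2])] at hc
    omega
  obtain ⟨s, -, hs⟩ := M.c_grid k hk.le
  obtain ⟨t, -, ht⟩ := M.c_grid (k+1) hk
  have hst : (s : ℝ) < t := by rw [hs, ht] at hlt; linarith
  have hst' : s + 1 ≤ t := by exact_mod_cast hst
  have hst2 : (s : ℝ) + 1 ≤ t := by exact_mod_cast hst'
  apply mul_nonneg (by positivity)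
  apply Real.log_nonneg
  rw [hs, ht]; linarith

lemma cost_ge (M : exH) (hM : M.Compatible exD) :
    Real.logb 2 2.865 + Real.log M.K ≤ M.cEnum := by
  have h1 := logStar_ge M.K
  have h2 : Real.log M.K ≤ Real.log (Nat.choose (101 + M.K - 1) (M.K - 1)) := by
    apply Real.log_le_log
    · exact_mod_cast M.K_pos
    · obtain ⟨k, hk⟩ : ∃ k, M.K = k + 1 := ⟨M.K - 1, by have := M.K_pos; omega⟩
      rw [hk]
      have : Nat.choose (k + 1) k ≤ Nat.choose (101 + (k+1) - 1) (k + 1 - 1) :=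
        Nat.choose_le_choose _ (by omega)
      rw [Nat.choose_succ_self_right] at this
      exact_mod_cast this
  have h3 : 0 ≤ Real.log (Nat.choose (6 + M.K - 1) (M.K - 1)) := Real.log_natCast_nonneg _
  have h4 : ∑ k ∈ Finset.range M.K, Real.log (Nat.factorial (M.h k)) ≤
      Real.log (Nat.factorial 6) := by
    rw [← Real.log_prod (fun i _ => by positivity)]
    apply Real.log_le_log (Finset.prod_pos fun i _ => by positivity)
    have := Nat.le_of_dvd (Nat.factorial_pos _)
      (Nat.prod_factorial_dvd_factorial_sum (Finset.range M.K) M.h)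
    rw [M.h_sum] at this
    exact_mod_cast this
  have h5 := Finset.sum_nonneg (s := Finset.range M.K)
    fun k hk => term_nonneg M hM k (Finset.mem_range.1 hk)
  have aux : ∀ a l s c d f g e : ℝ, a ≤ s → l ≤ c → 0 ≤ d → g ≤ f → 0 ≤ e →
      a + l ≤ s + c + d + (f - g) + e := by intros; linarith
  exact aux _ _ _ _ _ _ _ _ h1 h2 h3 h4 h5

lemma finite_costs (B : ℕ) : {x : ℝ | ∃ M : exH, M.K ≤ B ∧ M.Compatible exD ∧ M.cEnum = x}.Finite := by
  let F : Fin (B+1) × (Fin (B+1) → Fin 102) × (Fin (B+1) → Fin 7) → ℝ := fun p =>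
    logStar p.1 + Real.log (Nat.choose (101 + p.1 - 1) (p.1 - 1))
    + Real.log (Nat.choose (6 + p.1 - 1) (p.1 - 1))
    + (Real.log (Nat.factorial 6)
        - ∑ k ∈ Finset.range p.1, Real.log (Nat.factorial (p.2.2 (Fin.ofNat (B+1) k))))
    + ∑ k ∈ Finset.range p.1, ((p.2.2 (Fin.ofNat (B+1) k) : ℕ) : ℝ) *
      Real.log ((((0 : ℝ) - 1 / 2 + ((p.2.1 (Fin.ofNat (B+1) (k + 1)) : ℕ) : ℝ) * 1) -
        ((0 : ℝ) - 1 / 2 + ((p.2.1 (Fin.ofNat (B+1) k) : ℕ) : ℝ) * 1)) / 1)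
  apply (Set.finite_range F).subset
  rintro x ⟨M, hB, -, rfl⟩
  have hg : ∀ k, ∃ t : ℕ, t < 102 ∧ (k ≤ M.K → M.c k = 0 - 1 / 2 + (t : ℝ) * 1) := by
    intro k
    by_cases hk : k ≤ M.K
    · obtain ⟨t, ht, h⟩ := M.c_grid k hk
      exact ⟨t, by omega, fun _ => h⟩
    · exact ⟨0, by norm_num, fun h => absurd h hk⟩
  choose t ht htc using hg
  have hh : ∀ k < M.K, M.h k < 7 := by
    intro k hk
    have := Finset.single_le_sum (f := M.h) (fun i _ => Nat.zero_le _) (Finset.mem_range.2 hk)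
    rw [M.h_sum] at this
    omega
  refine ⟨(⟨M.K, by omega⟩, fun k => ⟨t k, ht k⟩, fun k => Fin.ofNat 7 (M.h k)), ?_⟩
  have e1 : ∀ k ≤ M.K, ((Fin.ofNat (B+1) k : Fin (B+1)) : ℕ) = k := fun k hk =>
    Nat.mod_eq_of_lt (by omega)
  have e2 : ∀ k < M.K, ((Fin.ofNat 7 (M.h k) : Fin 7) : ℕ) = M.h k := fun k hk =>
    Nat.mod_eq_of_lt (hh k hk)
  simp only [F]
  unfold Histogram.cEnum
  congr 1
  · congr 2
    apply Finset.sum_congr rfl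
    intro k hk
    have hk := Finset.mem_range.1 hk
    rw [e1 k hk.le, e2 k hk]
  · apply Finset.sum_congr rfl
    intro k hk
    have hk := Finset.mem_range.1 hk
    rw [e1 k hk.le, e2 k hk, e1 (k+1) hk, htc k hk.le, htc (k+1) hk]

lemma exists_opt : ∃ M : exH, M.Optimal exD := by
  obtain ⟨B, hB⟩ := exists_nat_ge (Real.exp (exM.cEnum - Real.logb 2 2.865))
  have key : ∀ M : exH, M.Compatible exD → M.cEnum ≤ exM.cEnum → M.K ≤ B := by
    intro M hM hle
    have := cost_ge M hM
    have hK : (0 : ℝ) < M.K := by exact_mod_cast M.K_pos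
    have h2 : (M.K : ℝ) ≤ Real.exp (exM.cEnum - Real.logb 2 2.865) := by
      rw [← Real.log_le_iff_le_exp hK]; linarith
    exact_mod_cast h2.trans hB
  have hmem : exM.cEnum ∈ {x : ℝ | ∃ M : exH, M.K ≤ B ∧ M.Compatible exD ∧ M.cEnum = x} :=
    ⟨exM, key _ exM_compat le_rfl, exM_compat, rfl⟩
  obtain ⟨x, ⟨M, hMB, hMc, rfl⟩, hmin⟩ := Set.exists_min_image _ id (finite_costs B) ⟨_, hmem⟩
  refine ⟨M, hMc, fun M' hM' => ?_⟩
  rcases le_total M'.cEnum exM.cEnum with h | h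
  · exact hmin _ ⟨M', key M' hM' h, hM', rfl⟩
  · exact (hmin _ hmem).trans h

lemma three_le_log : (3 : ℝ) ≤ Real.log 27 := by
  have h : (1 : ℝ) ≤ Real.log 3 := by
    rw [Real.le_log_iff_exp_le (by norm_num)]; exact Real.exp_one_lt_three.le
  rw [show (27 : ℝ) = 3 ^ 3 by norm_num, Real.log_pow]
  push_cast; linarith

lemma nonempty_cost (M : exH) (hM : M.Compatible exD) (h : ∀ k < M.K, M.h k ≠ 0) :
    exM.cEnum < M.cEnum := by
  have h3 := three_le_log
  have hin : ∀ k < M.K, (M.c k < 0 ∧ 0 ≤ M.c (k+1)) ∨ (M.c k < 100 ∧ 100 ≤ M.c (k+1)) := by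
    intro k hk
    by_contra hcon
    push Not at hcon
    have hc := hM k hk
    rw [exD_count, if_neg (by intro h; linarith [hcon.1 h.1, h.2]),
      if_neg (by intro h; linarith [hcon.2 h.1, h.2])] at hc
    exact h k hk hc.symm
  have hc1 : 0 ≤ M.c 1 := by
    rcases hin 0 M.K_pos with h | h <;> simp at h <;> linarith
  have hK : M.K < 3 := by
    by_contra hcon
    have a := hin 1 (by omega)
    have b := hin 2 (by omega)
    norm_num at a b
    rcases a with a | a <;> rcases b with b | b <;> linarith
  have hf := M.c_first
  have hl := M.c_last
  have hp := M.K_pos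
  have hs := logStar_ge M.K
  have hsum := M.h_sum
  rw [exM_cost]
  have hcase : M.K = 1 ∨ M.K = 2 := by omega
  rcases hcase with hK1 | hK2
  · unfold Histogram.cEnum
    rw [hK1] at hl hs hsum ⊢
    simp at hsum
    simp only [Finset.sum_range_succ, Finset.sum_range_zero, hsum, hf, hl, zero_add]
    norm_num [Nat.factorial]
    have : Real.log 27 + Real.log 182104 + Real.log 84 + Real.log 720 < 6 * Real.log 101 + (Real.log 6 + Real.log 6) := by
      rw [← Real.log_mul (by norm_num) (by norm_num), ← Real.log_mul (by norm_num) (by norm_num),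
        ← Real.log_mul (by norm_num) (by norm_num), ← Real.log_mul (by norm_num) (by norm_num),
        show (6 : ℝ) * Real.log 101 = Real.log (101 ^ 6) by rw [Real.log_pow]; norm_num,
        ← Real.log_mul (by norm_num) (by norm_num)]
      apply Real.log_lt_log <;> norm_num
    linarith
  · have hc2 : M.c 1 < 100 := by
      rcases hin 1 (by omega) with h | h <;> linarith
    have g0 := hM 0 (by omega)
    have g1 := hM 1 (by omega)
    obtain ⟨t, ht, htc⟩ := M.c_grid 1 (by omega)
    unfold Histogram.cEnum
    rw [hK2] at hl hs ⊢
    rw [exD_count] at g0 g1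
    norm_num at g0 g1
    rw [hf, if_pos ⟨by norm_num, hc1⟩, if_neg (by intro h; linarith)] at g0
    rw [hl, if_neg (by intro h; linarith), if_pos ⟨hc2, by norm_num⟩] at g1
    have t1 : 1 ≤ t := by
      by_contra hcon
      have : t = 0 := by omega
      rw [htc, this] at hc1; norm_num at hc1
    have t2 : t ≤ 100 := by
      by_contra hcon
      have : (101 : ℝ) ≤ t := by exact_mod_cast (by omega : 101 ≤ t)
      linarith
    have t1' : (1 : ℝ) ≤ t := by exact_mod_cast t1
    have t2' : (t : ℝ) ≤ 100 := by exact_mod_cast t2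
    have hlog : Real.log 100 ≤ Real.log t + Real.log (101 - t) := by
      rw [← Real.log_mul (by linarith) (by linarith)]
      apply Real.log_le_log (by norm_num)
      nlinarith
    simp only [Finset.sum_range_succ, Finset.sum_range_zero, ← g0, ← g1, zero_add]
    norm_num
    rw [hf, hl, htc]
    rw [show (0 - 1 / 2 + (t : ℝ) * 1 - (0 - 1 / 2)) = t by ring,
      show (100 + 1 / 2 - (0 - 1 / 2 + (t : ℝ) * 1)) = 101 - t by ring]
    have : Real.log 27 + Real.log 182104 + Real.log 84 < Real.log 102 + Real.log 7 + 3 * Real.log 100 := by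
      rw [← Real.log_mul (by norm_num) (by norm_num), ← Real.log_mul (by norm_num) (by norm_num),
        show (3 : ℝ) * Real.log 100 = Real.log (100 ^ 3) by rw [Real.log_pow]; norm_num,
        ← Real.log_mul (by norm_num) (by norm_num), ← Real.log_mul (by norm_num) (by norm_num)]
      apply Real.log_lt_log <;> norm_num
    linarith

/-- there are an accuracy and a data set for which every optimal
histogram has an interval containing no observation. -/
theorem stmt6 :
    ∃ (n : ℕ) (ε xmin xmax : ℝ) (E : ℕ) (D : Fin n → ℝ),
      1 ≤ n ∧ 0 < ε ∧ IsGLB (Set.range D) xmin ∧ IsLUB (Set.range D) xmax ∧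
      1 ≤ E ∧ (E : ℝ) = 1 + (xmax - xmin) / ε ∧
      (∃ M : Histogram n ε xmin xmax E, M.Optimal D) ∧
      ∀ M : Histogram n ε xmin xmax E, M.Optimal D → ∃ k < M.K, M.h k = 0 := by
  refine ⟨6, 1, 0, 100, 101, exD, by norm_num, by norm_num, ?_, ?_, by norm_num, by norm_num,
    exists_opt, ?_⟩
  · apply IsLeast.isGLB
    refine ⟨⟨0, rfl⟩, ?_⟩
    rintro _ ⟨i, rfl⟩
    fin_cases i <;> simp [exD]
  · apply IsGreatest.isLUB
    refine ⟨⟨5, rfl⟩, ?_⟩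
    rintro _ ⟨i, rfl⟩
    fin_cases i <;> simp [exD]
  · intro M hM
    by_contra hcon
    push Not at hcon
    exact absurd (hM.2 exM exM_compat) (not_le.2 (nonempty_cost M hM.1 hcon))
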